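/- arXiv:1207.6572 — 3 statements merged into one kernel-verified Lean document; each statement's English description precedes it below -/
import Mathlib

section
/- Let A be a nonzero nonnegative n×n matrix and let r ≥ 0. Then the set C_{A,r} is nonempty if and only if r > 0 and r ≥ μ(A). -/
open Filter Relation

namespace MaxAlg

/-- Max-algebraic action of a matrix on a vector: `(A ⊗ x) i = max_j A i j * x j`. -/
noncomputable def maxVec {n : ℕ} (A : Fin n → Fin n → ℝ) (x : Fin n → ℝ) : Fin n → ℝ :=
  fun i => ⨆ j, A i j * x j

/-- Max-algebraic matrix product: `(A ⊗ B) i k = max_j A i j * B j k`. -/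
noncomputable def maxMul {n : ℕ} (A B : Fin n → Fin n → ℝ) : Fin n → Fin n → ℝ :=
  fun i k => ⨆ j, A i j * B j k

/-- The weight of the cycle determined by a list `[i₁, …, i_k]`,
namely `A i₁ i₂ * ⋯ * A i_{k-1} i_k * A i_k i₁`. -/
noncomputable def cycleProd {n : ℕ} (A : Fin n → Fin n → ℝ) (l : List (Fin n)) : ℝ :=
  ((l.zip (l.rotate 1)).map fun p => A p.1 p.2).prod

/-- The maximal cycle geometric mean of `A`: the supremum over all cycles of distinct
nodes of the k-th root of the cycle weight. -/
noncomputable def mu {n : ℕ} (A : Fin n → Fin n → ℝ) : ℝ :=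
  sSup {c | ∃ l : List (Fin n), l ≠ [] ∧ l.Nodup ∧ c = cycleProd A l ^ ((l.length : ℝ)⁻¹)}

/-- `C_{A,r}`: the positive vectors with `A ⊗ x ≤ r x`. -/
def Cset {n : ℕ} (A : Fin n → Fin n → ℝ) (r : ℝ) : Set (Fin n → ℝ) :=
  {x | (∀ i, 0 < x i) ∧ ∀ i, maxVec A x i ≤ r * x i}

/-- A critical cycle: a cycle of distinct nodes attaining `mu A`. -/
def IsCriticalCycle {n : ℕ} (A : Fin n → Fin n → ℝ) (l : List (Fin n)) : Prop :=
  l ≠ [] ∧ l.Nodup ∧ cycleProd A l ^ ((l.length : ℝ)⁻¹) = mu A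

/-- `(i,j) ∈ E^C(A)`: the edge `(i,j)` lies on some critical cycle. -/
def criticalEdge {n : ℕ} (A : Fin n → Fin n → ℝ) (i j : Fin n) : Prop :=
  ∃ l : List (Fin n), IsCriticalCycle A l ∧ (i, j) ∈ l.zip (l.rotate 1)

/-- `i ∈ N^C(A)`: the node `i` lies on some critical cycle. -/
def criticalNode {n : ℕ} (A : Fin n → Fin n → ℝ) (i : Fin n) : Prop :=
  ∃ l : List (Fin n), IsCriticalCycle A l ∧ i ∈ l

/-- Irreducibility: the digraph of `A` (edge `(i,j)` iff `A i j > 0`) is strongly connected. -/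
def Irred {n : ℕ} (A : Fin n → Fin n → ℝ) : Prop :=
  ∀ i j, Relation.ReflTransGen (fun a b => 0 < A a b) i j

/-- Max-algebraic product of a word of matrices from the family `A`. -/
noncomputable def wordProd {n m : ℕ} (A : Fin m → Fin n → Fin n → ℝ) :
    List (Fin m) → (Fin n → Fin n → ℝ)
  | [] => fun i j => if i = j then 1 else 0
  | [j] => A j
  | j :: k :: w => maxMul (A j) (wordProd A (k :: w))

/-- The max version of the generalised spectral radius
`μ̂(Ψ) = limsup_{p→∞} (max_{ψ ∈ Ψ^p_⊗} μ(ψ))^{1/p}`. -/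
noncomputable def genSpecRad {n m : ℕ} (A : Fin m → Fin n → Fin n → ℝ) : ℝ :=
  Filter.limsup
    (fun p : ℕ =>
      (sSup {c | ∃ w : List (Fin m), w.length = p ∧ c = mu (wordProd A w)}) ^ ((p : ℝ)⁻¹))
    Filter.atTop

/-- `S = A₁ ⊕ ⋯ ⊕ A_m`: the entrywise maximum of the family. -/
noncomputable def Smat {n m : ℕ} (A : Fin m → Fin n → Fin n → ℝ) : Fin n → Fin n → ℝ :=
  fun i j => ⨆ k, A k i j

/-- The relative error function `e_A(x) = max_{i,j} A i j * x j / x i`. -/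
noncomputable def errF {n : ℕ} (A : Fin n → Fin n → ℝ) (x : Fin n → ℝ) : ℝ :=
  ⨆ i, ⨆ j, A i j * x j / x i

/-- A symmetrically reciprocal (SR) matrix: positive, with unit diagonal and
`A i j * A j i = 1` for `i ≠ j`. -/
def IsSR {n : ℕ} (A : Fin n → Fin n → ℝ) : Prop :=
  (∀ i j, 0 < A i j) ∧ (∀ i, A i i = 1) ∧ ∀ i j, i ≠ j → A i j * A j i = 1

/-- Max-algebraic matrix powers. -/
noncomputable def maxPow {n : ℕ} (B : Fin n → Fin n → ℝ) : ℕ → (Fin n → Fin n → ℝ)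
  | 0 => fun i j => if i = j then 1 else 0
  | p + 1 => maxMul B (maxPow B p)

/-- The Kleene star `B* = I ⊕ B ⊕ B⊗² ⊕ ⋯ ⊕ B⊗^{n-1}`. -/
noncomputable def kleeneStar {n : ℕ} (B : Fin n → Fin n → ℝ) : Fin n → Fin n → ℝ :=
  fun i j => ⨆ p : Fin n, maxPow B p i j

/-- The weight of the walk that starts at `i` and visits the nodes of the list in order. -/
def walkWeight {n : ℕ} (B : Fin n → Fin n → ℝ) : Fin n → List (Fin n) → ℝ
  | _, [] => 1
  | i, j :: l => B i j * walkWeight B j l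

lemma walkWeight_nonneg {n : ℕ} {B : Fin n → Fin n → ℝ} (hB : ∀ i j, 0 ≤ B i j)
    (i : Fin n) (l : List (Fin n)) : 0 ≤ walkWeight B i l := by
  induction l generalizing i with
  | nil => exact zero_le_one
  | cons j l ih => exact mul_nonneg (hB i j) (ih j)

lemma walkWeight_append_cons {n : ℕ} (B : Fin n → Fin n → ℝ) (i k : Fin n)
    (s t : List (Fin n)) :
    walkWeight B i (s ++ k :: t) = walkWeight B i (s ++ [k]) * walkWeight B k t := by
  induction s generalizing i with
  | nil => simp [walkWeight]
  | cons j s ih => simp only [List.cons_append, walkWeight, ih j, mul_assoc]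

lemma cycleProd_cons {n : ℕ} (B : Fin n → Fin n → ℝ) (i : Fin n) (s : List (Fin n)) :
    cycleProd B (i :: s) = walkWeight B i (s ++ [i]) := by
  have key : ∀ (s : List (Fin n)) (i k : Fin n),
      (((i :: s).zip (s ++ [k])).map fun p => B p.1 p.2).prod = walkWeight B i (s ++ [k]) := by
    intro s
    induction s with
    | nil => intro i k; simp [walkWeight]
    | cons j s ih =>
      intro i k
      simp only [List.cons_append, List.zip_cons_cons, List.map_cons, List.prod_cons, walkWeight]
      rw [← ih j k]
  simpa [cycleProd] using key s i i

lemma cycleProd_nonneg {n : ℕ} {A : Fin n → Fin n → ℝ} (hA : ∀ i j, 0 ≤ A i j)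
    (l : List (Fin n)) : 0 ≤ cycleProd A l := by
  refine List.prod_nonneg fun a ha => ?_
  obtain ⟨p, -, rfl⟩ := List.mem_map.1 ha
  exact hA _ _

lemma cycleProd_div {n : ℕ} (A : Fin n → Fin n → ℝ) (r : ℝ) (l : List (Fin n)) :
    cycleProd (fun i j => A i j / r) l = cycleProd A l / r ^ l.length := by
  simp [cycleProd, div_eq_mul_inv, List.prod_map_mul]

lemma cycleProd_le_pow {n : ℕ} {A : Fin n → Fin n → ℝ} (hA : ∀ i j, 0 ≤ A i j)
    {r : ℝ} (hr : 0 ≤ r) {x : Fin n → ℝ} (hx : ∀ i, 0 < x i)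
    (h : ∀ i j, A i j * x j ≤ r * x i) (l : List (Fin n)) :
    cycleProd A l ≤ r ^ l.length := by
  have key : ∀ l m : List (Fin n), l.length = m.length →
      ((l.zip m).map fun p => A p.1 p.2).prod * (m.map x).prod ≤
        r ^ l.length * (l.map x).prod := by
    intro l
    induction l with
    | nil => intro m hm; simp [List.length_eq_zero_iff.1 hm.symm]
    | cons a l ih =>
      rintro (_ | ⟨b, m⟩) hm
      · simp at hm
      · have h1 := ih m (by simpa using hm)
        have h2 : 0 ≤ ((l.zip m).map fun p => A p.1 p.2).prod * (m.map x).prod := by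
          refine mul_nonneg (List.prod_nonneg ?_) (List.prod_nonneg ?_)
          · intro c hc
            obtain ⟨p, -, rfl⟩ := List.mem_map.1 hc
            exact hA _ _
          · intro c hc
            obtain ⟨p, -, rfl⟩ := List.mem_map.1 hc
            exact (hx p).le
        have h3 := mul_le_mul (h a b) h1 h2 (mul_nonneg hr (hx a).le)
        simp only [List.zip_cons_cons, List.map_cons, List.prod_cons, List.length_cons, pow_succ]
        linarith
  have hpos : 0 < (l.map x).prod := by
    refine List.prod_pos fun c hc => ?_
    obtain ⟨p, -, rfl⟩ := List.mem_map.1 hc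
    exact hx p
  have hk := key l (l.rotate 1) (by simp)
  rw [((List.rotate_perm l 1).map x).prod_eq] at hk
  exact le_of_mul_le_mul_right hk hpos

lemma rpow_inv_length_le_iff {n : ℕ} {A : Fin n → Fin n → ℝ} (hA : ∀ i j, 0 ≤ A i j)
    {r : ℝ} (hr : 0 ≤ r) {l : List (Fin n)} (hl : l ≠ []) :
    cycleProd A l ^ ((l.length : ℝ)⁻¹) ≤ r ↔ cycleProd A l ≤ r ^ l.length := by
  rw [Real.rpow_inv_le_iff_of_pos (cycleProd_nonneg hA l) hr
    (by exact_mod_cast List.length_pos_iff.2 hl), Real.rpow_natCast]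

lemma mu_le_iff {n : ℕ} {A : Fin n → Fin n → ℝ} (hA : ∀ i j, 0 ≤ A i j)
    {r : ℝ} (hr : 0 ≤ r) :
    mu A ≤ r ↔ ∀ l : List (Fin n), l ≠ [] → l.Nodup → cycleProd A l ≤ r ^ l.length := by
  constructor
  · intro h l hl hnd
    rw [← rpow_inv_length_le_iff hA hr hl]
    refine le_trans ?_ h
    refine le_csSup ?_ ⟨l, hl, hnd, rfl⟩
    refine ((Set.finite_range fun l : {l : List (Fin n) // l.Nodup} =>
      cycleProd A l.1 ^ ((l.1.length : ℝ)⁻¹)).subset ?_).bddAbove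
    rintro c ⟨l, -, hnd, rfl⟩
    exact ⟨⟨l, hnd⟩, rfl⟩
  · intro h
    refine Real.sSup_le ?_ hr
    rintro c ⟨l, hl, hnd, rfl⟩
    exact (rpow_inv_length_le_iff hA hr hl).2 (h l hl hnd)

/-- If no elementary cycle of `B` has weight above `1`, then the maximal weights of elementary
paths form a positive subeigenvector of `B`. -/
lemma exists_pos_subeigenvector {n : ℕ} {B : Fin n → Fin n → ℝ} (hB : ∀ i j, 0 ≤ B i j)
    (h : ∀ l : List (Fin n), l ≠ [] → l.Nodup → cycleProd B l ≤ 1) :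
    ∃ x : Fin n → ℝ, (∀ i, 0 < x i) ∧ ∀ i j, B i j * x j ≤ x i := by
  have hmax : ∀ i, ∃ l : List (Fin n), (i :: l).Nodup ∧
      ∀ m : List (Fin n), (i :: m).Nodup → walkWeight B i m ≤ walkWeight B i l := by
    intro i
    have hfin : {l : List (Fin n) | (i :: l).Nodup}.Finite :=
      (Set.finite_coe_iff.1 (Finite.of_fintype {l : List (Fin n) // l.Nodup})).subset fun l hl => (List.nodup_cons.1 hl).2
    exact Set.exists_max_image _ (walkWeight B i) hfin ⟨[], List.nodup_singleton i⟩
  choose p hp hpmax using hmax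
  refine ⟨fun i => walkWeight B i (p i), fun i => ?_, fun i j => ?_⟩
  · exact zero_lt_one.trans_le (hpmax i [] (List.nodup_singleton i))
  · change walkWeight B i (j :: p j) ≤ _
    by_cases hi : i ∈ j :: p j
    · obtain ⟨s, t, hst⟩ := List.append_of_mem hi
      have hnd := hp j
      rw [hst] at hnd
      rw [hst, walkWeight_append_cons, ← cycleProd_cons]
      have hcyc : cycleProd B (i :: s) ≤ 1 := by
        refine h _ (List.cons_ne_nil _ _) ?_
        have := List.nodup_middle.1 hnd
        exact this.sublist ((List.sublist_append_left s t).cons_cons i)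
      exact (mul_le_of_le_one_left (walkWeight_nonneg hB i t) hcyc).trans
        (hpmax i t hnd.of_append_right)
    · exact hpmax i _ (List.nodup_cons.2 ⟨hi, hp j⟩)

lemma mem_Cset_iff {n : ℕ} {A : Fin n → Fin n → ℝ} {r : ℝ} (hr : 0 ≤ r) {x : Fin n → ℝ} :
    x ∈ Cset A r ↔ (∀ i, 0 < x i) ∧ ∀ i j, A i j * x j ≤ r * x i := by
  refine and_congr_right fun hx => forall_congr' fun i => ?_
  exact ⟨fun h j => (le_ciSup (f := fun j => A i j * x j) (Set.finite_range _).bddAbove j).trans h,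
    fun h => Real.iSup_le h (mul_nonneg hr (hx i).le)⟩

/-- For a nonzero nonnegative `n × n` matrix `A` and `r ≥ 0`,
the set `C_{A,r}` is nonempty iff `r > 0` and `r ≥ μ(A)`. -/
theorem stmt0 {n : ℕ} (A : Fin n → Fin n → ℝ) (hA : ∀ i j, 0 ≤ A i j)
    (hA0 : A ≠ 0) (r : ℝ) (hr : 0 ≤ r) :
    (Cset A r).Nonempty ↔ 0 < r ∧ mu A ≤ r := by
  constructor
  · rintro ⟨x, hx⟩
    obtain ⟨hpos, hle⟩ := (mem_Cset_iff hr).1 hx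
    refine ⟨?_, (mu_le_iff hA hr).2 fun l _ _ => cycleProd_le_pow hA hr hpos hle l⟩
    obtain ⟨i, hi⟩ := Function.ne_iff.1 hA0
    obtain ⟨j, hj⟩ := Function.ne_iff.1 hi
    have hij : 0 < A i j := lt_of_le_of_ne (hA i j) (Ne.symm hj)
    exact pos_of_mul_pos_left ((mul_pos hij (hpos j)).trans_le (hle i j)) (hpos i).le
  · rintro ⟨hr0, hmu⟩
    obtain ⟨x, hpos, hle⟩ := exists_pos_subeigenvector (B := fun i j => A i j / r)
      (fun i j => div_nonneg (hA i j) hr) fun l hl hnd => by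
        rw [cycleProd_div]
        exact div_le_one_of_le₀ ((mu_le_iff hA hr).1 hmu l hl hnd) (pow_nonneg hr _)
    refine ⟨x, (mem_Cset_iff hr).2 ⟨hpos, fun i j => ?_⟩⟩
    have hij := hle i j
    rwa [div_mul_eq_mul_div, div_le_iff₀' hr0] at hij

end MaxAlg
end

section
/- Let A and B be nonnegative n×n matrices with μ(A) = μ(B) = 1, and suppose μ(A ⊕ B) = 1, where A ⊕ B is the entrywise maximum. Then: (i) a_{ij} = b_{ij} for every edge (i,j) ∈ E^C(A) ∩ E^C(B); and (ii) a_{ij} b_{ji} = 1 whenever (i,j) ∈ E^C(A) and (j,i) ∈ E^C(B). -/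
open Filter Relation

namespace MaxAlg

/-- The weight of the path visiting the nodes of a list in order. -/
def pathWeight {n : ℕ} (A : Fin n → Fin n → ℝ) : List (Fin n) → ℝ
  | [] => 1
  | [_] => 1
  | i :: j :: l => A i j * pathWeight A (j :: l)

lemma pathWeight_append {n : ℕ} (A : Fin n → Fin n → ℝ) (i : Fin n) (q : List (Fin n)) :
    ∀ p, pathWeight A (p ++ i :: q) = pathWeight A (p ++ [i]) * pathWeight A (i :: q)
  | [] => by simp [pathWeight]
  | [a] => by simp [pathWeight]
  | a :: b :: p => by
    have := pathWeight_append A i q (b :: p)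
    simp only [List.cons_append, pathWeight] at this ⊢
    rw [this, mul_assoc]

lemma pathWeight_nonneg {n : ℕ} {A : Fin n → Fin n → ℝ} (hA : ∀ i j, 0 ≤ A i j) :
    ∀ l, 0 ≤ pathWeight A l
  | [] => zero_le_one
  | [_] => zero_le_one
  | i :: j :: l => mul_nonneg (hA i j) (pathWeight_nonneg hA (j :: l))

lemma cycleProd_cons_s8 {n : ℕ} (A : Fin n → Fin n → ℝ) (a : Fin n) (l : List (Fin n)) :
    cycleProd A (a :: l) = pathWeight A (a :: (l ++ [a])) := by
  have aux (c : Fin n) (l : List (Fin n)) : ∀ b,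
      (((b :: l).zip (l ++ [c])).map fun p => A p.1 p.2).prod =
        pathWeight A (b :: (l ++ [c])) := by
    induction l with
    | nil => simp [pathWeight]
    | cons d l ih => intro b; simpa [pathWeight] using Or.inl (ih d)
  simpa [cycleProd] using aux a l a

lemma finite_setOf_nodup (n : ℕ) : {l : List (Fin n) | l.Nodup}.Finite :=
  (List.finite_length_le (Fin n) n).subset fun l hl => by
    simpa using List.Nodup.length_le_card hl

lemma cycleProd_rpow_le_mu {n : ℕ} (A : Fin n → Fin n → ℝ) {l : List (Fin n)}
    (hne : l ≠ []) (hl : l.Nodup) : cycleProd A l ^ ((l.length : ℝ)⁻¹) ≤ mu A := by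
  refine le_csSup (Set.Finite.bddAbove ?_) ⟨l, hne, hl, rfl⟩
  refine ((finite_setOf_nodup n).image
    fun l => cycleProd A l ^ ((l.length : ℝ)⁻¹)).subset ?_
  rintro c ⟨l, -, hl, rfl⟩
  exact ⟨l, hl, rfl⟩

lemma cycleProd_le_one {n : ℕ} {A : Fin n → Fin n → ℝ} (hmu : mu A = 1)
    {l : List (Fin n)} (hne : l ≠ []) (hl : l.Nodup) : cycleProd A l ≤ 1 := by
  by_contra! h
  have hpos : 0 < (l.length : ℝ)⁻¹ := by
    have := List.length_pos_iff.2 hne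
    positivity
  exact (Real.one_lt_rpow h hpos).not_ge (hmu ▸ cycleProd_rpow_le_mu A hne hl)

/-- A nonnegative matrix with maximal cycle mean `1` has a positive max-subeigenvector: take
`x i` to be the largest weight of a simple path starting at `i`. -/
lemma exists_pos_subeigenvector_s8 {n : ℕ} {A : Fin n → Fin n → ℝ} (hA : ∀ i j, 0 ≤ A i j)
    (hmu : mu A = 1) : ∃ x : Fin n → ℝ, (∀ i, 0 < x i) ∧ ∀ i j, A i j * x j ≤ x i := by
  have hfin (i : Fin n) : {l : List (Fin n) | (i :: l).Nodup}.Finite :=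
    (finite_setOf_nodup n).subset fun l hl => (List.nodup_cons.1 hl).2
  have hmax (i : Fin n) := Set.exists_max_image _ (fun l => pathWeight A (i :: l)) (hfin i)
    ⟨[], List.nodup_singleton i⟩
  choose P hP hPmax using hmax
  refine ⟨fun i => pathWeight A (i :: P i), fun i => ?_, fun i j => ?_⟩
  · exact zero_lt_one.trans_le (hPmax i [] (List.nodup_singleton i))
  · by_cases hi : i ∈ j :: P j
    · obtain ⟨p, q, hpq⟩ := List.append_of_mem hi
      have hnd : (p ++ i :: q).Nodup := hpq ▸ hP j
      have hq : (i :: q).Nodup := hnd.of_append_right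
      have hp : (i :: p).Nodup := (List.nodup_middle.1 hnd).sublist (by simp)
      have hcyc := cycleProd_le_one hmu (List.cons_ne_nil i p) hp
      have hhead : A i j * pathWeight A (p ++ [i]) = pathWeight A (i :: (p ++ [i])) := by
        cases p <;> simp_all [pathWeight]
      rw [cycleProd_cons_s8, ← hhead] at hcyc
      calc A i j * pathWeight A (j :: P j)
          = A i j * pathWeight A (p ++ [i]) * pathWeight A (i :: q) := by
            rw [hpq, pathWeight_append, mul_assoc]
        _ ≤ pathWeight A (i :: q) := mul_le_of_le_one_left (pathWeight_nonneg hA _) hcyc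
        _ ≤ pathWeight A (i :: P i) := hPmax i q hq
    · exact hPmax i (j :: P j) (List.nodup_cons.2 ⟨hi, hP j⟩)

lemma eq_one_of_mem_of_prod_eq_one {l : List ℝ} (hl : ∀ c ∈ l, 0 ≤ c ∧ c ≤ 1)
    (hprod : l.prod = 1) : ∀ c ∈ l, c = 1 := by
  induction l with
  | nil => simp
  | cons a l ih =>
    simp only [List.forall_mem_cons, List.prod_cons] at hl hprod ⊢
    have h0 : 0 ≤ l.prod := List.prod_nonneg fun c hc => (hl.2 c hc).1
    have ha : l.prod ≤ 1 := by
      simpa using List.prod_map_le_pow_length₀ (f := MonoidHom.id ℝ) (r := 1) (fun c hc => (hl.2 c hc).1)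
        (fun c hc => (hl.2 c hc).2)
    exact ⟨by nlinarith, ih hl.2 (by nlinarith)⟩

/-- Conjugating by a positive diagonal matrix does not change cycle weights. -/
lemma cycleProd_diag_conj {n : ℕ} (A : Fin n → Fin n → ℝ) {x : Fin n → ℝ}
    (hx : ∀ i, 0 < x i) (l : List (Fin n)) :
    cycleProd (fun i j => A i j * x j / x i) l = cycleProd A l := by
  have hlen : l.length = (l.rotate 1).length := (List.length_rotate ..).symm
  have hfst : ((l.zip (l.rotate 1)).map fun p => x p.1) = l.map x := by
    conv_rhs => rw [← List.map_fst_zip hlen.le, List.map_map]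
    rfl
  have hsnd : ((l.zip (l.rotate 1)).map fun p => x p.2) = (l.rotate 1).map x := by
    conv_rhs => rw [← List.map_snd_zip hlen.ge, List.map_map]
    rfl
  have hpos : 0 < (l.map x).prod := List.prod_pos fun c hc => by
    obtain ⟨i, -, rfl⟩ := List.mem_map.1 hc
    exact hx i
  have hdiv := Multiset.prod_map_div (m := (l.zip (l.rotate 1) : Multiset (Fin n × Fin n)))
    (f := fun p => A p.1 p.2 * x p.2) (g := fun p => x p.1)
  simp only [Multiset.map_coe, Multiset.prod_coe] at hdiv
  rw [cycleProd, hdiv, List.prod_map_mul, hfst, hsnd,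
    ((List.rotate_perm l 1).map x).prod_eq, mul_div_cancel_right₀ _ hpos.ne', cycleProd]

/-- A positive max-subeigenvector is tight on the critical edges. -/
lemma criticalEdge.mul_eq {n : ℕ} {A : Fin n → Fin n → ℝ} (hA : ∀ i j, 0 ≤ A i j)
    (hmu : mu A = 1) {x : Fin n → ℝ} (hx : ∀ i, 0 < x i) (hAx : ∀ i j, A i j * x j ≤ x i)
    {i j : Fin n} (h : criticalEdge A i j) : A i j * x j = x i := by
  obtain ⟨l, ⟨hne, -, hl⟩, hij⟩ := h
  have hlen : (l.length : ℝ) ≠ 0 := by simpa using hne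
  rw [hmu, Real.rpow_inv_eq (cycleProd_nonneg hA l) zero_le_one hlen, Real.one_rpow, ← cycleProd_diag_conj A hx] at hl
  refine (div_eq_one_iff_eq (hx i).ne').1 <|
    eq_one_of_mem_of_prod_eq_one ?_ hl _ (List.mem_map.2 ⟨(i, j), hij, rfl⟩)
  intro c hc
  obtain ⟨p, -, rfl⟩ := List.mem_map.1 hc
  exact ⟨div_nonneg (mul_nonneg (hA _ _) (hx _).le) (hx _).le,
    (div_le_one (hx _)).2 (hAx _ _)⟩

/-- if `μ(A) = μ(B) = 1` and `μ(A ⊕ B) = 1` then critical edges common to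
both carry equal entries, and opposite critical edges multiply to `1`. -/
theorem stmt8 {n : ℕ} (A B : Fin n → Fin n → ℝ)
    (hA : ∀ i j, 0 ≤ A i j) (hB : ∀ i j, 0 ≤ B i j)
    (hmuA : mu A = 1) (hmuB : mu B = 1)
    (hmuS : mu (fun i j => max (A i j) (B i j)) = 1) :
    (∀ i j, criticalEdge A i j → criticalEdge B i j → A i j = B i j) ∧
    (∀ i j, criticalEdge A i j → criticalEdge B j i → A i j * B j i = 1) := by
  obtain ⟨x, hx, hSx⟩ := exists_pos_subeigenvector_s8
    (fun i j => (hA i j).trans (le_max_left _ (B i j))) hmuS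
  have hAx (i j) : A i j * x j ≤ x i :=
    (mul_le_mul_of_nonneg_right (le_max_left _ _) (hx j).le).trans (hSx i j)
  have hBx (i j) : B i j * x j ≤ x i :=
    (mul_le_mul_of_nonneg_right (le_max_right _ _) (hx j).le).trans (hSx i j)
  refine ⟨fun i j hi hj => ?_, fun i j hi hj => ?_⟩
  · exact mul_right_cancel₀ (hx j).ne'
      ((hi.mul_eq hA hmuA hx hAx).trans (hj.mul_eq hB hmuB hx hBx).symm)
  · refine mul_right_cancel₀ (hx i).ne' ?_
    rw [mul_assoc, hj.mul_eq hB hmuB hx hBx, hi.mul_eq hA hmuA hx hAx, one_mul]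

end MaxAlg
end

section
/- Let A_1, …, A_m be n×n SR-matrices and suppose x ∈ int(ℝ^n_+) is a positive vector with A_i⊗x ≤ μ(A_i)·x for all i = 1,…,m. Then for every i and all indices k, l: μ(A_i)^{-1} ≤ (A_i)_{kl} x_l / x_k ≤ μ(A_i); moreover, if (k,l) ∈ E^C(A_i) then (A_i)_{kl} x_l / x_k = μ(A_i), and if (l,k) ∈ E^C(A_i) then (A_i)_{kl} x_l / x_k = μ(A_i)^{-1}. -/
open Filter Relation

namespace MaxAlg

/-- A list of positive factors bounded by `c` whose product is `c ^ length` is constant. -/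
theorem eq_of_prod_map_eq_pow {α : Type*} (f : α → ℝ) (c : ℝ) (L : List α)
    (hpos : ∀ a, 0 < f a) (hle : ∀ a, f a ≤ c)
    (h : (L.map f).prod = c ^ L.length) : ∀ a ∈ L, f a = c := by
  have hprod_pos (L : List α) : 0 < (L.map f).prod :=
    List.prod_pos (by simpa using fun a _ => hpos a)
  have hprod_le (L : List α) : (L.map f).prod ≤ c ^ L.length := by
    induction L with
    | nil => simp
    | cons a L ih =>
      have := mul_le_mul (hle a) ih (hprod_pos L).le ((hpos a).le.trans (hle a))
      simpa [pow_succ'] using this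
  induction L with
  | nil => simp
  | cons a L ih =>
    have hc : 0 < c := (hpos a).trans_le (hle a)
    simp only [List.map_cons, List.prod_cons, List.length_cons, pow_succ'] at h
    have ha : f a = c := by
      refine (hle a).antisymm (le_of_mul_le_mul_right ?_ (pow_pos hc L.length))
      exact h.ge.trans (mul_le_mul_of_nonneg_left (hprod_le L) (hpos a).le)
    rw [ha] at h
    intro b hb
    rcases List.mem_cons.mp hb with rfl | hb
    · exact ha
    · exact ih (mul_left_cancel₀ hc.ne' h) b hb

/-- Cycle weights are invariant under diagonal similarity scaling. -/
theorem cycleProd_scaling {n : ℕ} (A : Fin n → Fin n → ℝ) (x : Fin n → ℝ)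
    (hx : ∀ i, 0 < x i) (l : List (Fin n)) :
    cycleProd (fun i j => A i j * x j / x i) l = cycleProd A l := by
  have key (L : List (Fin n × Fin n)) :
      (L.map fun p => A p.1 p.2 * x p.2 / x p.1).prod * ((L.map Prod.fst).map x).prod =
        (L.map fun p => A p.1 p.2).prod * ((L.map Prod.snd).map x).prod := by
    induction L with
    | nil => simp
    | cons p L ih =>
      have hp := (hx p.1).ne'
      simp only [List.map_cons, List.prod_cons]
      rw [mul_mul_mul_comm, ih, div_mul_cancel₀ _ hp]
      ring
  have h := key (l.zip (l.rotate 1))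
  rw [List.map_fst_zip (by simp), List.map_snd_zip (by simp),
    ((l.rotate_perm 1).map x).prod_eq] at h
  exact mul_right_cancel₀ (List.prod_pos (by simpa using fun a _ => hx a)).ne' h

/-- If the maximal cycle mean bounds all scaled entries, it is attained on critical edges. -/
theorem scaled_entry_eq_mu_of_criticalEdge {n : ℕ} (A : Fin n → Fin n → ℝ)
    (hA : ∀ i j, 0 < A i j) (x : Fin n → ℝ) (hx : ∀ i, 0 < x i)
    (hle : ∀ i j, A i j * x j / x i ≤ mu A) {k l : Fin n} (h : criticalEdge A k l) :
    A k l * x l / x k = mu A := by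
  obtain ⟨c, ⟨hne, -, hc⟩, hmem⟩ := h
  have hnonneg : 0 ≤ cycleProd A c :=
    List.prod_nonneg (by
      intro a ha
      obtain ⟨p, -, rfl⟩ := List.mem_map.mp ha
      exact (hA _ _).le)
  have hpow : cycleProd A c = mu A ^ c.length := by
    rw [← hc, Real.rpow_inv_natCast_pow hnonneg (by simpa using hne)]
  rw [← cycleProd_scaling A x hx] at hpow
  refine eq_of_prod_map_eq_pow (fun p : Fin n × Fin n => A p.1 p.2 * x p.2 / x p.1) (mu A)
    (c.zip (c.rotate 1)) (fun p => div_pos (mul_pos (hA _ _) (hx _)) (hx _))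
    (fun p => hle _ _) ?_ (k, l) hmem
  simpa [cycleProd] using hpow

/-- simultaneous visualisation of SR-matrices. If `x` is a common positive
subeigenvector of SR-matrices `A₁, …, A_m`, then all scaled entries lie between
`μ(A_i)⁻¹` and `μ(A_i)`, with equality on critical resp. anticritical edges. -/
theorem stmt11 {n m : ℕ} (hm : 0 < m) (A : Fin m → Fin n → Fin n → ℝ)
    (hSR : ∀ t, IsSR (A t)) (x : Fin n → ℝ) (hx : ∀ i, 0 < x i)
    (hsub : ∀ t i, maxVec (A t) x i ≤ mu (A t) * x i) :
    ∀ t k l,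
      ((mu (A t))⁻¹ ≤ A t k l * x l / x k ∧ A t k l * x l / x k ≤ mu (A t)) ∧
      (criticalEdge (A t) k l → A t k l * x l / x k = mu (A t)) ∧
      (criticalEdge (A t) l k → A t k l * x l / x k = (mu (A t))⁻¹) := by
  intro t
  obtain ⟨hpos, hdiag, hrec⟩ := hSR t
  have hle (i j : Fin n) : A t i j * x j / x i ≤ mu (A t) :=
    (div_le_iff₀ (hx i)).mpr
      ((le_ciSup (Set.finite_range fun j => A t i j * x j).bddAbove j).trans (hsub t i))
  have hinv (i j : Fin n) : A t i j * x j / x i = (A t j i * x i / x j)⁻¹ := by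
    have hij : A t i j * A t j i = 1 := by
      rcases eq_or_ne i j with rfl | h
      · simp [hdiag]
      · exact hrec i j h
    have hi := (hx i).ne'
    have hj := (hx j).ne'
    refine eq_inv_of_mul_eq_one_left ?_
    field_simp
    exact hij
  intro k l
  refine ⟨⟨?_, hle k l⟩, scaled_entry_eq_mu_of_criticalEdge (A t) hpos x hx hle, fun h => ?_⟩
  · rw [hinv]
    exact inv_anti₀ (div_pos (mul_pos (hpos _ _) (hx _)) (hx _)) (hle l k)
  · rw [hinv, scaled_entry_eq_mu_of_criticalEdge (A t) hpos x hx hle h]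

end MaxAlg
end
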